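/- arXiv:1108.5140 — 3 statements merged into one kernel-verified Lean document; each statement's English description precedes it below -/
import Mathlib

section
/- Let A ∈ ℝ^{n×n}, B ∈ ℝ^{n×m}, C ∈ ℝ^{p×n}, D ∈ ℝ^{p×m}, q ≥ 0, and let Q, R, R̂ be real symmetric n×n matrices such that I_m − BᵀRB − qDᵀD and I_m − BᵀR̂B − qDᵀD are invertible and AᵀRA − R + qCᵀC + Q + (AᵀRB + qCᵀD)(I_m − BᵀRB − qDᵀD)⁻¹(BᵀRA + qDᵀC) = 0 and AᵀR̂A − R̂ + qCᵀC + (AᵀR̂B + qCᵀD)(I_m − BᵀR̂B − qDᵀD)⁻¹(BᵀR̂A + qDᵀC) = 0. Then, with Ā := A + B(I_m − BᵀR̂B − qDᵀD)⁻¹(BᵀR̂A + qDᵀC), the difference Δ := R − R̂ satisfies the identity Δ = ĀᵀΔĀ + ĀᵀΔB(I_m − qDᵀD − BᵀRB)⁻¹BᵀΔĀ + Q. -/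
open Matrix

/-- Completion of squares: the closed-loop quadratic form of `Δ` under the feedback `K`, in terms of
the open-loop data, where `S - T = BᵀΔA`, `N - M = BᵀΔB` and `N * K = T`. -/
theorem closedLoop_quadratic_form {ι κ α : Type*} [Fintype ι] [Fintype κ] [DecidableEq κ]
    [CommRing α] {A Δ : Matrix ι ι α} {B : Matrix ι κ α} {S T K : Matrix κ ι α}
    {M N : Matrix κ κ α} (hΔ : Δ.IsSymm) (hM : M.IsSymm) (hMdet : IsUnit M.det)
    (hST : Bᵀ * Δ * A = S - T) (hNM : Bᵀ * Δ * B = N - M) (hK : N * K = T) :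
    (A + B * K)ᵀ * Δ * (A + B * K) +
        (A + B * K)ᵀ * Δ * B * M⁻¹ * Bᵀ * Δ * (A + B * K) =
      Aᵀ * Δ * A + Sᵀ * M⁻¹ * S - Tᵀ * K := by
  have hST' : Aᵀ * Δ * B = Sᵀ - Tᵀ := by
    simpa [Matrix.transpose_mul, hΔ.eq, Matrix.mul_assoc] using congrArg Matrix.transpose hST
  have hright : Bᵀ * Δ * (A + B * K) = S - M * K := by
    rw [Matrix.mul_add, ← Matrix.mul_assoc, hST, hNM, Matrix.sub_mul, hK]
    abel
  have hleft : (A + B * K)ᵀ * Δ * B = Sᵀ - Kᵀ * M := by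
    simpa [Matrix.transpose_mul, hΔ.eq, hM.eq, Matrix.mul_assoc] using
      congrArg Matrix.transpose hright
  have hsquare : (A + B * K)ᵀ * Δ * B * M⁻¹ * Bᵀ * Δ * (A + B * K) =
      Sᵀ * M⁻¹ * S - Sᵀ * K - Kᵀ * S + Kᵀ * (M * K) := by
    calc
      _ = ((A + B * K)ᵀ * Δ * B) * M⁻¹ * (Bᵀ * Δ * (A + B * K)) := by
        simp only [Matrix.mul_assoc]
      _ = (Sᵀ * M⁻¹ - Kᵀ) * (S - M * K) := by
        rw [hleft, hright, Matrix.sub_mul, Matrix.mul_nonsing_inv_cancel_right _ _ hMdet]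
      _ = _ := by
        rw [Matrix.sub_mul, Matrix.mul_sub, Matrix.mul_sub, ← Matrix.mul_assoc (Sᵀ * M⁻¹),
          Matrix.nonsing_inv_mul_cancel_right _ _ hMdet]
        abel
  have hlinear : (A + B * K)ᵀ * Δ * (A + B * K) =
      Aᵀ * Δ * A + (Sᵀ - Tᵀ) * K + Kᵀ * (S - M * K) := by
    rw [Matrix.transpose_add, Matrix.transpose_mul, Matrix.add_mul, Matrix.add_mul,
      Matrix.mul_assoc Kᵀ, Matrix.mul_assoc Kᵀ, hright, Matrix.mul_add, ← Matrix.mul_assoc, hST']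
  rw [hsquare, hlinear, Matrix.mul_sub, Matrix.sub_mul]
  abel

/-- the identity satisfied by the difference `Δ = R − R̂` of a solution of a
perturbed Riccati equation (with perturbation `Q`) and a solution of the unperturbed one. -/
theorem stmt_2 {n m p : ℕ}
    (A : Matrix (Fin n) (Fin n) ℝ) (B : Matrix (Fin n) (Fin m) ℝ)
    (C : Matrix (Fin p) (Fin n) ℝ) (D : Matrix (Fin p) (Fin m) ℝ)
    (q : ℝ) (hq : 0 ≤ q)
    (Q R Rh : Matrix (Fin n) (Fin n) ℝ)
    (hQsym : Q.IsSymm) (hRsym : R.IsSymm) (hRhsym : Rh.IsSymm)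
    (hRinv : IsUnit ((1 : Matrix (Fin m) (Fin m) ℝ) - Bᵀ * R * B - q • (Dᵀ * D)).det)
    (hRhinv : IsUnit ((1 : Matrix (Fin m) (Fin m) ℝ) - Bᵀ * Rh * B - q • (Dᵀ * D)).det)
    (hRicR : Aᵀ * R * A - R + q • (Cᵀ * C) + Q +
      (Aᵀ * R * B + q • (Cᵀ * D)) * ((1 : Matrix (Fin m) (Fin m) ℝ) - Bᵀ * R * B - q • (Dᵀ * D))⁻¹ *
        (Bᵀ * R * A + q • (Dᵀ * C)) = 0)
    (hRicRh : Aᵀ * Rh * A - Rh + q • (Cᵀ * C) +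
      (Aᵀ * Rh * B + q • (Cᵀ * D)) * ((1 : Matrix (Fin m) (Fin m) ℝ) - Bᵀ * Rh * B - q • (Dᵀ * D))⁻¹ *
        (Bᵀ * Rh * A + q • (Dᵀ * C)) = 0) :
    R - Rh =
      (A + B * ((1 : Matrix (Fin m) (Fin m) ℝ) - Bᵀ * Rh * B - q • (Dᵀ * D))⁻¹ *
          (Bᵀ * Rh * A + q • (Dᵀ * C)))ᵀ * (R - Rh) *
        (A + B * ((1 : Matrix (Fin m) (Fin m) ℝ) - Bᵀ * Rh * B - q • (Dᵀ * D))⁻¹ *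
          (Bᵀ * Rh * A + q • (Dᵀ * C))) +
      (A + B * ((1 : Matrix (Fin m) (Fin m) ℝ) - Bᵀ * Rh * B - q • (Dᵀ * D))⁻¹ *
          (Bᵀ * Rh * A + q • (Dᵀ * C)))ᵀ * (R - Rh) * B *
        ((1 : Matrix (Fin m) (Fin m) ℝ) - q • (Dᵀ * D) - Bᵀ * R * B)⁻¹ * Bᵀ * (R - Rh) *
        (A + B * ((1 : Matrix (Fin m) (Fin m) ℝ) - Bᵀ * Rh * B - q • (Dᵀ * D))⁻¹ *
          (Bᵀ * Rh * A + q • (Dᵀ * C))) +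
      Q := by
  set M := (1 : Matrix (Fin m) (Fin m) ℝ) - Bᵀ * R * B - q • (Dᵀ * D) with hM
  set N := (1 : Matrix (Fin m) (Fin m) ℝ) - Bᵀ * Rh * B - q • (Dᵀ * D) with hN
  set S := Bᵀ * R * A + q • (Dᵀ * C) with hS
  set T := Bᵀ * Rh * A + q • (Dᵀ * C) with hT
  have hSt : Aᵀ * R * B + q • (Cᵀ * D) = Sᵀ := by
    simp [hS, Matrix.transpose_mul, hRsym.eq, Matrix.mul_assoc]
  have hTt : Aᵀ * Rh * B + q • (Cᵀ * D) = Tᵀ := by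
    simp [hT, Matrix.transpose_mul, hRhsym.eq, Matrix.mul_assoc]
  have hMsymm : M.IsSymm := by
    simp [Matrix.IsSymm, hM, Matrix.transpose_mul, hRsym.eq, Matrix.mul_assoc]
  have hST : Bᵀ * (R - Rh) * A = S - T := by
    rw [Matrix.mul_sub, Matrix.sub_mul, hS, hT]
    abel
  have hNM : Bᵀ * (R - Rh) * B = N - M := by
    rw [Matrix.mul_sub, Matrix.sub_mul, hM, hN]
    abel
  rw [hSt] at hRicR
  rw [hTt, Matrix.mul_assoc Tᵀ] at hRicRh
  rw [sub_right_comm 1 (q • (Dᵀ * D)), ← hM, Matrix.mul_assoc B N⁻¹ T,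
    closedLoop_quadratic_form (hRsym.sub hRhsym) hMsymm hRinv hST hNM
      (Matrix.mul_nonsing_inv_cancel_left N T hRhinv),
    Matrix.mul_sub, Matrix.sub_mul, ← sub_eq_zero, ← neg_eq_zero]
  calc
    _ = (Aᵀ * R * A - R + q • (Cᵀ * C) + Q + Sᵀ * M⁻¹ * S) -
        (Aᵀ * Rh * A - Rh + q • (Cᵀ * C) + Tᵀ * (N⁻¹ * T)) := by abel
    _ = 0 := by rw [hRicR, hRicRh, sub_zero]
end

section
/- Fix A ∈ ℝ^{n×n}, B ∈ ℝ^{n×m}, C ∈ ℝ^{p×n}, D ∈ ℝ^{p×m}, γ > 0, and a > 0. The set of pairs (q, R), where q ∈ ℝ and R is a real symmetric n×n matrix, satisfying q > 0, R ≻ 0, the linear matrix inequality [[AᵀRA − R, AᵀRB],[BᵀRA, BᵀRB − I_m]] + q·[Cᵀ; Dᵀ]·[C, D] ≺ 0, and the inequality −(det(I_m − BᵀRB − qDᵀD))^{1/m} < −(1 − qγ²)·e^{2a/m}, is a convex subset of ℝ × Sym_n(ℝ). -/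
open Matrix

/-- The AM-GM inequality for the eigenvalues of a positive definite matrix. -/
theorem Matrix.PosDef.det_rpow_le_trace_div {ι : Type*} [Fintype ι] [DecidableEq ι] [Nonempty ι]
    {P : Matrix ι ι ℝ} (hP : P.PosDef) :
    P.det ^ ((1 : ℝ) / Fintype.card ι) ≤ P.trace / Fintype.card ι := by
  have h := Real.geom_mean_le_arith_mean Finset.univ (fun _ : ι => (1 : ℝ)) hP.1.eigenvalues
    (fun _ _ => zero_le_one) (by simp [Fintype.card_pos]) (fun i _ => (hP.eigenvalues_pos i).le)
  rw [hP.1.det_eq_prod_eigenvalues, hP.1.trace_eq_sum_eigenvalues]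
  simpa using h

theorem Matrix.PosDef.exists_conjTranspose_mul_mul_eq_one {ι : Type*} [Fintype ι] [DecidableEq ι]
    {S : Matrix ι ι ℝ} (hS : S.PosDef) :
    ∃ K : Matrix ι ι ℝ, IsUnit K ∧ Kᴴ * S * K = 1 := by
  obtain ⟨L, rfl⟩ : ∃ L : Matrix ι ι ℝ, S = Lᴴ * L := by
    open scoped MatrixOrder in
    exact CStarAlgebra.nonneg_iff_eq_star_mul_self.mp hS.posSemidef.nonneg
  have hL : IsUnit L.det := by
    have := hS.det_pos.ne'
    rw [det_mul] at this
    exact (right_ne_zero_of_mul this).isUnit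
  refine ⟨L⁻¹, (isUnit_nonsing_inv_iff).mpr ((isUnit_iff_isUnit_det L).mpr hL), ?_⟩
  rw [← Matrix.mul_assoc, ← conjTranspose_mul, mul_nonsing_inv L hL, conjTranspose_one,
    Matrix.one_mul, mul_nonsing_inv L hL]

/-- Minkowski's determinant inequality: `det ^ (1 / m)` is concave on positive definite
matrices of size `m`. -/
theorem Matrix.PosDef.le_det_smul_add_smul_rpow {ι : Type*} [Fintype ι] [DecidableEq ι] [Nonempty ι]
    {P Q : Matrix ι ι ℝ} (hP : P.PosDef) (hQ : Q.PosDef) {s t : ℝ} (hs : 0 < s) (ht : 0 < t) :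
    s * P.det ^ ((1 : ℝ) / Fintype.card ι) + t * Q.det ^ ((1 : ℝ) / Fintype.card ι) ≤
      (s • P + t • Q).det ^ ((1 : ℝ) / Fintype.card ι) := by
  have hS : (s • P + t • Q).PosDef := (hP.smul hs).add (hQ.smul ht)
  obtain ⟨K, hK, hKS⟩ := hS.exists_conjTranspose_mul_mul_eq_one
  have hKdet : 0 < K.det ^ 2 := by
    have := ((isUnit_iff_isUnit_det K).mp hK).ne_zero
    positivity
  have hdet (M : Matrix ι ι ℝ) (hM : 0 ≤ M.det) :
      (Kᴴ * M * K).det ^ ((1 : ℝ) / Fintype.card ι) =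
        (K.det ^ 2) ^ ((1 : ℝ) / Fintype.card ι) * M.det ^ ((1 : ℝ) / Fintype.card ι) := by
    rw [← Real.mul_rpow hKdet.le hM]
    congr 1
    simp only [det_mul, det_conjTranspose, star_trivial]
    ring
  have hinj : Function.Injective K.mulVec := mulVec_injective_of_isUnit hK
  have h₁ := (hP.conjTranspose_mul_mul_same hinj).det_rpow_le_trace_div
  have h₂ := (hQ.conjTranspose_mul_mul_same hinj).det_rpow_le_trace_div
  have h₃ := hdet _ hS.det_pos.le
  rw [hdet _ hP.det_pos.le] at h₁
  rw [hdet _ hQ.det_pos.le] at h₂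
  rw [hKS, det_one, Real.one_rpow] at h₃
  have htr : s * (Kᴴ * P * K).trace + t * (Kᴴ * Q * K).trace = Fintype.card ι := by
    rw [← trace_one (n := ι) (R := ℝ), ← hKS]
    simp [Matrix.mul_add, Matrix.add_mul]
  have hcard : (0 : ℝ) < Fintype.card ι := by exact_mod_cast Fintype.card_pos
  refine le_of_mul_le_mul_left ?_ (Real.rpow_pos_of_pos hKdet ((1 : ℝ) / Fintype.card ι))
  rw [← h₃]
  calc _ = s * ((K.det ^ 2) ^ ((1 : ℝ) / Fintype.card ι) * P.det ^ ((1 : ℝ) / Fintype.card ι)) +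
        t * ((K.det ^ 2) ^ ((1 : ℝ) / Fintype.card ι) *
          Q.det ^ ((1 : ℝ) / Fintype.card ι)) := by ring
    _ ≤ s * ((Kᴴ * P * K).trace / Fintype.card ι) +
        t * ((Kᴴ * Q * K).trace / Fintype.card ι) := by gcongr
    _ = (s * (Kᴴ * P * K).trace + t * (Kᴴ * Q * K).trace) / Fintype.card ι := by ring
    _ = 1 := by rw [htr, div_self hcard.ne']

/-- the set of pairs `(q, R)` (with `R` symmetric) satisfying `q > 0`, `R ≻ 0`,
the LMI, and the determinant inequality is convex. -/
theorem stmt_7 {n m p : ℕ}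
    (A : Matrix (Fin n) (Fin n) ℝ) (B : Matrix (Fin n) (Fin m) ℝ)
    (C : Matrix (Fin p) (Fin n) ℝ) (D : Matrix (Fin p) (Fin m) ℝ)
    (γ a : ℝ) (hγ : 0 < γ) (ha : 0 < a) :
    Convex ℝ {qR : ℝ × Matrix (Fin n) (Fin n) ℝ |
      qR.2.IsSymm ∧ 0 < qR.1 ∧ qR.2.PosDef ∧
      (-(Matrix.fromBlocks (Aᵀ * qR.2 * A - qR.2) (Aᵀ * qR.2 * B)
            (Bᵀ * qR.2 * A) (Bᵀ * qR.2 * B - 1) +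
          qR.1 • Matrix.fromBlocks (Cᵀ * C) (Cᵀ * D) (Dᵀ * C) (Dᵀ * D))).PosDef ∧
      -((1 : Matrix (Fin m) (Fin m) ℝ) - Bᵀ * qR.2 * B - qR.1 • (Dᵀ * D)).det ^ ((1 : ℝ) / m) <
        -(1 - qR.1 * γ ^ 2) * Real.exp (2 * a / m)} := by
  rw [convex_iff_forall_pos]
  rintro ⟨q₁, R₁⟩ ⟨hR₁, hq₁, hp₁, hl₁, hd₁⟩ ⟨q₂, R₂⟩ ⟨hR₂, hq₂, hp₂, hl₂, hd₂⟩ s t hs ht hst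
  simp only at hR₁ hq₁ hp₁ hl₁ hd₁ hR₂ hq₂ hp₂ hl₂ hd₂
  have hblock (q : ℝ) (R : Matrix (Fin n) (Fin n) ℝ)
      (h : (-(Matrix.fromBlocks (Aᵀ * R * A - R) (Aᵀ * R * B) (Bᵀ * R * A) (Bᵀ * R * B - 1) +
        q • Matrix.fromBlocks (Cᵀ * C) (Cᵀ * D) (Dᵀ * C) (Dᵀ * D))).PosDef) :
      (1 - Bᵀ * R * B - q • (Dᵀ * D)).PosDef := by
    convert h.submatrix (e := Sum.inr) Sum.inr_injective using 1
    ext i j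
    simp
    ring
  simp only [Set.mem_ofPred_eq, Prod.smul_mk, Prod.mk_add_mk]
  refine ⟨?_, ?_, ?_, ?_, ?_⟩
  · exact (hR₁.smul s).add (hR₂.smul t)
  · simp only [smul_eq_mul]
    positivity
  · exact (hp₁.smul hs).add (hp₂.smul ht)
  · convert (hl₁.smul hs).add (hl₂.smul ht) using 1
    obtain rfl : t = 1 - s := by linarith
    simp only [fromBlocks_smul, fromBlocks_add, fromBlocks_neg, Matrix.mul_add, Matrix.add_mul,
      Matrix.mul_smul, Matrix.smul_mul]
    congr 1 <;> module
  · have hcomb : (1 : Matrix (Fin m) (Fin m) ℝ) - Bᵀ * (s • R₁ + t • R₂) * B -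
        (s • q₁ + t • q₂) • (Dᵀ * D) =
        s • (1 - Bᵀ * R₁ * B - q₁ • (Dᵀ * D)) + t • (1 - Bᵀ * R₂ * B - q₂ • (Dᵀ * D)) := by
      obtain rfl : t = 1 - s := by linarith
      simp only [Matrix.mul_add, Matrix.add_mul, Matrix.mul_smul, Matrix.smul_mul]
      module
    have hdet : s * (1 - Bᵀ * R₁ * B - q₁ • (Dᵀ * D)).det ^ ((1 : ℝ) / m) +
        t * (1 - Bᵀ * R₂ * B - q₂ • (Dᵀ * D)).det ^ ((1 : ℝ) / m) ≤
        (1 - Bᵀ * (s • R₁ + t • R₂) * B - (s • q₁ + t • q₂) • (Dᵀ * D)).det ^ ((1 : ℝ) / m) := by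
      rw [hcomb]
      rcases Nat.eq_zero_or_pos m with rfl | hm
      · simp [hst]
      · have : Nonempty (Fin m) := ⟨⟨0, hm⟩⟩
        simpa using (hblock _ _ hl₁).le_det_smul_add_smul_rpow (hblock _ _ hl₂) hs ht
    have h₁ := mul_lt_mul_of_pos_left hd₁ hs
    have h₂ := mul_lt_mul_of_pos_left hd₂ ht
    have hlin : -(1 - (s • q₁ + t • q₂) * γ ^ 2) * Real.exp (2 * a / m) =
        s * (-(1 - q₁ * γ ^ 2) * Real.exp (2 * a / m)) +
          t * (-(1 - q₂ * γ ^ 2) * Real.exp (2 * a / m)) := by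
      obtain rfl : t = 1 - s := by linarith
      simp only [smul_eq_mul]
      ring
    rw [hlin]
    linarith
end

section
/- Let B ∈ ℝ^{n×m}, D ∈ ℝ^{p×m}, γ > 0, a ≥ 0, and let R̂ be a real symmetric n×n matrix with R̂ ⪰ 0. Let q satisfy 0 ≤ q < γ⁻² and suppose M := I_m − BᵀR̂B − qDᵀD ≻ 0. If −(1/2)·ln det((1 − qγ²)·M⁻¹) ≥ a, then γ⁻²·(1 − e^{−2a/m}) ≤ q < γ⁻². -/
open Matrix

/-- A positive definite real matrix dominated by the identity has determinant at most one. -/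
theorem Matrix.PosDef.det_le_one_of_posSemidef_one_sub {ι : Type*} [Fintype ι] [DecidableEq ι]
    {A : Matrix ι ι ℝ} (hA : A.PosDef) (h : (1 - A).PosSemidef) : A.det ≤ 1 := by
  rw [hA.isHermitian.det_eq_prod_eigenvalues]
  refine Finset.prod_le_one (fun i _ => (hA.eigenvalues_pos i).le) fun i _ => ?_
  set v : ι → ℝ := (hA.isHermitian.eigenvectorBasis i).ofLp with hv
  have hv0 : v ≠ 0 := fun h0 => hA.isHermitian.eigenvectorBasis.orthonormal.ne_zero i <| by
    ext j
    exact congrFun h0 j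
  have hpos : 0 < v ⬝ᵥ v := by simpa using dotProduct_star_self_pos_iff.2 hv0
  have hq := h.dotProduct_mulVec_nonneg v
  rw [sub_mulVec, one_mulVec, hv, hA.isHermitian.mulVec_eigenvectorBasis, ← hv, star_trivial,
    dotProduct_sub, dotProduct_smul, smul_eq_mul] at hq
  exact le_of_mul_le_mul_right (by simpa using hq) hpos

/-- localization of `q`, Remark 2 of the paper: if
`−(1/2)·ln det((1 − qγ²)·M⁻¹) ≥ a` for `M = I_m − BᵀR̂B − qDᵀD ≻ 0`, then
`γ⁻²(1 − e^{−2a/m}) ≤ q < γ⁻²`. -/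
theorem stmt_9 {n m p : ℕ}
    (B : Matrix (Fin n) (Fin m) ℝ) (D : Matrix (Fin p) (Fin m) ℝ)
    (γ a : ℝ) (hγ : 0 < γ) (ha : 0 ≤ a)
    (Rh : Matrix (Fin n) (Fin n) ℝ) (hRhsym : Rh.IsSymm) (hRh : Rh.PosSemidef)
    (q : ℝ) (hq0 : 0 ≤ q) (hqγ : q < γ⁻¹ ^ 2)
    (hM : ((1 : Matrix (Fin m) (Fin m) ℝ) - Bᵀ * Rh * B - q • (Dᵀ * D)).PosDef)
    (hani : -(1 / 2) * Real.log ((1 - q * γ ^ 2) •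
        ((1 : Matrix (Fin m) (Fin m) ℝ) - Bᵀ * Rh * B - q • (Dᵀ * D))⁻¹).det ≥ a) :
    γ⁻¹ ^ 2 * (1 - Real.exp (-2 * a / m)) ≤ q ∧ q < γ⁻¹ ^ 2 := by
  refine ⟨?_, hqγ⟩
  set M := (1 : Matrix (Fin m) (Fin m) ℝ) - Bᵀ * Rh * B - q • (Dᵀ * D) with hMdef
  have hγ2 : 0 < γ ^ 2 := by positivity
  have hpos : 0 < 1 - q * γ ^ 2 := by
    have := mul_lt_mul_of_pos_right hqγ hγ2
    rw [← mul_pow, inv_mul_cancel₀ hγ.ne', one_pow] at this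
    linarith
  have hdet : M.det ≤ 1 := by
    refine hM.det_le_one_of_posSemidef_one_sub ?_
    have h1 : (Bᵀ * Rh * B).PosSemidef := by
      simpa [conjTranspose_eq_transpose_of_trivial] using hRh.conjTranspose_mul_mul_same B
    have h2 : (Dᵀ * D).PosSemidef := by
      simpa [conjTranspose_eq_transpose_of_trivial] using posSemidef_conjTranspose_mul_self D
    have h3 : 1 - M = Bᵀ * Rh * B + q • (Dᵀ * D) := by rw [hMdef]; abel
    rw [h3]
    exact h1.add (h2.smul hq0)
  have hlog : m * Real.log (1 - q * γ ^ 2) ≤ -2 * a := by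
    have hM0 := hM.det_pos
    rw [det_smul, Fintype.card_fin, det_nonsing_inv, Ring.inverse_eq_inv',
      Real.log_mul (by positivity) (by positivity), Real.log_pow, Real.log_inv] at hani
    have := Real.log_nonpos hM0.le hdet
    linarith
  have hexp : 1 - q * γ ^ 2 ≤ Real.exp (-2 * a / m) := by
    rcases Nat.eq_zero_or_pos m with rfl | hm
    · simp only [Nat.cast_zero, div_zero, Real.exp_zero]
      nlinarith [mul_nonneg hq0 hγ2.le]
    · rw [← Real.log_le_iff_le_exp hpos, le_div_iff₀ (by exact_mod_cast hm)]
      linarith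
  rw [inv_pow, inv_mul_le_iff₀ hγ2]
  linarith
end
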